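/- arXiv:2001.00310 — 5 statements merged into one kernel-verified Lean document; each statement's English description precedes it below -/
import Mathlib

section
/- Let Φ be a Euclidean ring and π = (h₁, h₂) an automorphism of Φ[x₁,x₂]. If the leading monomials of h₁ and h₂ are equal, then π is elementarily D-reducible. -/
open MvPolynomial

/-- The group of `Φ`-algebra automorphisms of `Φ[x₁,x₂]`. -/
abbrev PolyAut (Φ : Type*) [CommRing Φ] :=
  MvPolynomial (Fin 2) Φ ≃ₐ[Φ] MvPolynomial (Fin 2) Φ

/-- `Φ` together with `ν` is a Euclidean ring: an integral domain, not a field, with a norm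
`ν` on nonzero elements such that (E1) `ν a ≤ ν (a*b)` with equality iff `b` is a unit, and
(E2) division with remainder holds. -/
structure IsEuclideanNorm (Φ : Type*) [CommRing Φ] [IsDomain Φ] (ν : Φ → ℕ) : Prop where
  not_field : ¬ IsField Φ
  norm_le : ∀ a b : Φ, a ≠ 0 → b ≠ 0 → ν a ≤ ν (a * b)
  norm_eq_iff_unit : ∀ a b : Φ, a ≠ 0 → b ≠ 0 → (ν (a * b) = ν a ↔ IsUnit b)
  division : ∀ a b : Φ, b ≠ 0 → ∃ q r : Φ, a = b * q + r ∧ (r = 0 ∨ ν r < ν b)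

/-- The monomial `x₁^l x₂^m` is encoded by the pair `(l + m, l)`; the lexicographic order on
these pairs is exactly the order `u < v` iff `deg u < deg v`, or `deg u = deg v` and
`deg_{x₁} u < deg_{x₁} v`. -/
def mkey (d : Fin 2 →₀ ℕ) : ℕ ×ₗ ℕ := toLex (d 0 + d 1, d 0)

/-- The key of the leading monomial of `f`: the largest key of a monomial in the support. -/
noncomputable def leadKey {Φ : Type*} [CommRing Φ] (f : MvPolynomial (Fin 2) Φ) : ℕ ×ₗ ℕ :=
  f.support.sup mkey

/-- The leading monomial `f̄` of `f` (as an exponent vector). -/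
noncomputable def leadMon {Φ : Type*} [CommRing Φ] (f : MvPolynomial (Fin 2) Φ) :
    Fin 2 →₀ ℕ :=
  Finsupp.single 0 (ofLex (leadKey f)).2 +
    Finsupp.single 1 ((ofLex (leadKey f)).1 - (ofLex (leadKey f)).2)

/-- The leading coefficient `lc f` of `f`. -/
noncomputable def lc {Φ : Type*} [CommRing Φ] (f : MvPolynomial (Fin 2) Φ) : Φ :=
  f.coeff (leadMon f)

/-- The leading term `f′ = lc(f)·f̄` of `f`. -/
noncomputable def leadTerm {Φ : Type*} [CommRing Φ] (f : MvPolynomial (Fin 2) Φ) :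
    MvPolynomial (Fin 2) Φ :=
  monomial (leadMon f) (lc f)

/-- The value `D(φ) = (u, v, ν(lc f₁) + ν(lc f₂)) ∈ W² × ℕ` of an automorphism
`φ = (f₁, f₂)`, where `{u, v} = {f̄₁, f̄₂}`, `u ≥ v`, monomials being encoded by their keys,
and `W² × ℕ` carries the lexicographic order. -/
noncomputable def DAut {Φ : Type*} [CommRing Φ] (ν : Φ → ℕ) (φ : PolyAut Φ) :
    Lex ((ℕ ×ₗ ℕ) × Lex ((ℕ ×ₗ ℕ) × ℕ)) :=
  toLex (max (leadKey (φ (X 0))) (leadKey (φ (X 1))),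
    toLex (min (leadKey (φ (X 0))) (leadKey (φ (X 1))),
      ν (lc (φ (X 0))) + ν (lc (φ (X 1)))))

/-- The value `(x₁, x₂, 2e)` where `e = ν 1`. -/
def DId (e : ℕ) : Lex ((ℕ ×ₗ ℕ) × Lex ((ℕ ×ₗ ℕ) × ℕ)) :=
  toLex (toLex (1, 1), toLex (toLex (1, 0), 2 * e))

/-- `ψ` is obtained from `θ` by a single elementary transformation: one component `fᵢ` of
`θ = (f₁, f₂)` is replaced by `αfᵢ + g` with `α` a unit and `g` in the `Φ`-subalgebra
generated by the other component. -/
def ElemStep {Φ : Type*} [CommRing Φ] (θ ψ : PolyAut Φ) : Prop :=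
  (∃ (α : Φˣ) (g : MvPolynomial (Fin 2) Φ), g ∈ Algebra.adjoin Φ {θ (X 1)} ∧
      ψ (X 0) = C (α : Φ) * θ (X 0) + g ∧ ψ (X 1) = θ (X 1)) ∨
  (∃ (α : Φˣ) (g : MvPolynomial (Fin 2) Φ), g ∈ Algebra.adjoin Φ {θ (X 0)} ∧
      ψ (X 0) = θ (X 0) ∧ ψ (X 1) = C (α : Φ) * θ (X 1) + g)

/-- `θ` admits an elementary `D`-reduction: some elementary transformation of `θ` yields an
automorphism `ψ` with `D(ψ) ≺ D(θ)`. -/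
def ElemDReducible {Φ : Type*} [CommRing Φ] (ν : Φ → ℕ) (θ : PolyAut Φ) : Prop :=
  ∃ ψ : PolyAut Φ, ElemStep θ ψ ∧ DAut ν ψ < DAut ν θ

theorem mkey_injective : Function.Injective mkey := by
  intro d e h
  have h' : (d 0 + d 1, d 0) = (e 0 + e 1, e 0) := toLex.injective h
  simp only [Prod.mk.injEq] at h'
  ext i
  fin_cases i
  · exact h'.2
  · have := h'.1
    have := h'.2
    simp only [Fin.mk_one, Fin.isValue]
    omega

theorem le_leadKey {Φ : Type*} [CommRing Φ] {f : MvPolynomial (Fin 2) Φ} {d : Fin 2 →₀ ℕ}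
    (hd : f.coeff d ≠ 0) : mkey d ≤ leadKey f :=
  Finset.le_sup (f := mkey) (mem_support_iff.mpr hd)

theorem leadMon_eq_of_mkey_eq {Φ : Type*} [CommRing Φ] {f : MvPolynomial (Fin 2) Φ}
    {d : Fin 2 →₀ ℕ} (hd : leadKey f = mkey d) : leadMon f = d := by
  ext i
  fin_cases i <;> simp [leadMon, hd, mkey]

theorem lc_ne_zero {Φ : Type*} [CommRing Φ] {f : MvPolynomial (Fin 2) Φ} (hf : f ≠ 0) :
    lc f ≠ 0 := by
  obtain ⟨d, hd, he⟩ := Finset.exists_mem_eq_sup f.support (support_nonempty.mpr hf) mkey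
  rw [lc, leadMon_eq_of_mkey_eq he]
  exact mem_support_iff.mp hd

theorem mkey_leadMon {Φ : Type*} [CommRing Φ] {f : MvPolynomial (Fin 2) Φ} (hf : f ≠ 0) :
    mkey (leadMon f) = leadKey f := by
  obtain ⟨d, -, he⟩ := Finset.exists_mem_eq_sup f.support (support_nonempty.mpr hf) mkey
  rw [leadMon_eq_of_mkey_eq he]
  exact he.symm

theorem eq_C_of_leadKey_eq_bot {Φ : Type*} [CommRing Φ] {f : MvPolynomial (Fin 2) Φ}
    (hf : leadKey f = ⊥) : f = C (f.coeff 0) := by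
  ext d
  rw [coeff_C]
  split_ifs with hd
  · rw [hd]
  · by_contra hne
    have hle : mkey d ≤ ⊥ := hf ▸ le_leadKey hne
    exact hd (mkey_injective (le_antisymm (hle.trans bot_le) bot_le |>.trans
      (show (⊥ : ℕ ×ₗ ℕ) = mkey 0 from rfl)) |>.symm)

theorem bot_lt_leadKey_apply_X {Φ : Type*} [CommRing Φ] [Nontrivial Φ] (π : PolyAut Φ)
    (i : Fin 2) : ⊥ < leadKey (π (X i)) := by
  rw [bot_lt_iff_ne_bot]
  intro h
  have hC : π (X i) = π (C ((π (X i)).coeff 0)) := by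
    rw [← algebraMap_eq, π.commutes, algebraMap_eq]
    exact eq_C_of_leadKey_eq_bot h
  have := congrArg totalDegree (π.injective hC)
  simp at this

/-- Division with remainder of the leading coefficients lowers the leading monomial or
the norm of the leading coefficient. -/
theorem exists_add_C_mul_lt {Φ : Type*} [CommRing Φ] [IsDomain Φ] {ν : Φ → ℕ}
    (hν : IsEuclideanNorm Φ ν) {f g : MvPolynomial (Fin 2) Φ} (hf : ⊥ < leadKey f)
    (hg : g ≠ 0) (hfg : leadKey f = leadKey g) (hle : ν (lc g) ≤ ν (lc f)) :
    ∃ p : Φ, leadKey (f + C p * g) < leadKey f ∨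
      leadKey (f + C p * g) = leadKey f ∧ ν (lc (f + C p * g)) < ν (lc f) := by
  obtain ⟨q, r, hqr, hr⟩ := hν.division (lc f) (lc g) (lc_ne_zero hg)
  have hf0 : f ≠ 0 := by
    rintro rfl
    simp [leadKey] at hf
  have hmon : leadMon f = leadMon g := by
    apply mkey_injective
    rw [mkey_leadMon hf0, mkey_leadMon hg, hfg]
  have hcoeff : (f + C (-q) * g).coeff (leadMon f) = r := by
    rw [coeff_add, coeff_C_mul]
    change lc f + -q * g.coeff (leadMon f) = r
    rw [hmon]
    change lc f + -q * lc g = r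
    rw [hqr]
    ring
  have hle' : leadKey (f + C (-q) * g) ≤ leadKey f := by
    refine Finset.sup_le fun d hd => ?_
    by_contra hlt
    have h1 : f.coeff d = 0 := by
      by_contra hne
      exact hlt (le_leadKey hne)
    have h2 : g.coeff d = 0 := by
      by_contra hne
      exact hlt (hfg ▸ le_leadKey hne)
    simp [h1, h2] at hd
  refine ⟨-q, ?_⟩
  rcases hle'.lt_or_eq with hlt | heq
  · exact Or.inl hlt
  · right
    have hne : f + C (-q) * g ≠ 0 := by
      intro h0
      rw [h0] at heq
      exact hf.ne heq
    have hlc : lc (f + C (-q) * g) = r := by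
      rw [lc, leadMon_eq_of_mkey_eq (heq.trans (mkey_leadMon hf0).symm), hcoeff]
    have hr0 : r ≠ 0 := hlc ▸ lc_ne_zero hne
    exact ⟨heq, hlc ▸ (hr.resolve_left hr0).trans_le hle⟩

/-- The elementary automorphism `Xᵢ ↦ Xᵢ + p Xⱼ` fixing the other variable. -/
noncomputable def shear {Φ : Type*} [CommRing Φ] {i j : Fin 2} (hij : i ≠ j) (p : Φ) :
    PolyAut Φ :=
  AlgEquiv.ofAlgHom
    (aeval (Function.update X i (X i + C p * X j)))
    (aeval (Function.update X i (X i + C (-p) * X j)))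
    (by
      ext k : 1
      by_cases hk : k = i
      · subst hk
        simp [hij.symm]
      · simp [hk])
    (by
      ext k : 1
      by_cases hk : k = i
      · subst hk
        simp [hij.symm]
      · simp [hk])

theorem shear_X_self {Φ : Type*} [CommRing Φ] {i j : Fin 2} (hij : i ≠ j) (p : Φ) :
    shear hij p (X i) = X i + C p * X j := by
  simp [shear]

theorem shear_X_of_ne {Φ : Type*} [CommRing Φ] {i j : Fin 2} (hij : i ≠ j) (p : Φ) :
    shear hij p (X j) = X j := by
  simp [shear, hij.symm]

theorem apply_C {Φ : Type*} [CommRing Φ] (π : PolyAut Φ) (p : Φ) : π (C p) = C p :=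
  π.commutes p

theorem C_mul_mem_adjoin {Φ : Type*} [CommRing Φ] (p : Φ) (g : MvPolynomial (Fin 2) Φ) :
    C p * g ∈ Algebra.adjoin Φ {g} := by
  rw [← smul_eq_C_mul]
  exact Subalgebra.smul_mem _ (Algebra.self_mem_adjoin_singleton Φ g) p

/-- If the leading monomials of the two components of an automorphism `π = (h₁, h₂)` of
`Φ[x₁,x₂]` over a Euclidean ring `Φ` are equal, then `π` is elementarily `D`-reducible. -/
theorem elemDReducible_of_leadMon_eq
    (Φ : Type*) [CommRing Φ] [IsDomain Φ] (ν : Φ → ℕ) (hν : IsEuclideanNorm Φ ν)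
    (π : PolyAut Φ) (h : leadMon (π (X 0)) = leadMon (π (X 1))) :
    ElemDReducible ν π := by
  have hne : ∀ i, π (X i) ≠ 0 := fun i => by simp
  have hkey : leadKey (π (X 0)) = leadKey (π (X 1)) := by
    rw [← mkey_leadMon (hne 0), ← mkey_leadMon (hne 1), h]
  rcases le_total (ν (lc (π (X 1)))) (ν (lc (π (X 0)))) with hle | hle
  · obtain ⟨p, hp⟩ := exists_add_C_mul_lt hν (bot_lt_leadKey_apply_X π 0) (hne 1) hkey hle
    have h0 : ((shear zero_ne_one p).trans π) (X 0) = π (X 0) + C p * π (X 1) := by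
      simp [shear_X_self, apply_C]
    have h1 : ((shear zero_ne_one p).trans π) (X 1) = π (X 1) := by
      simp [shear_X_of_ne]
    refine ⟨(shear zero_ne_one p).trans π, Or.inl ⟨1, C p * π (X 1),
      C_mul_mem_adjoin _ _, by simp [h0], h1⟩, ?_⟩
    rw [DAut, DAut, h0, h1, ← hkey]
    rcases hp with hp | ⟨hp, hp'⟩
    · simp [Prod.Lex.toLex_lt_toLex, hp, hp.le]
    · simp [Prod.Lex.toLex_lt_toLex, hp, hp']
  · obtain ⟨p, hp⟩ := exists_add_C_mul_lt hν (bot_lt_leadKey_apply_X π 1) (hne 0) hkey.symm hle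
    have h0 : ((shear one_ne_zero p).trans π) (X 0) = π (X 0) := by
      simp [shear_X_of_ne]
    have h1 : ((shear one_ne_zero p).trans π) (X 1) = π (X 1) + C p * π (X 0) := by
      simp [shear_X_self, apply_C]
    refine ⟨(shear one_ne_zero p).trans π, Or.inr ⟨1, C p * π (X 0),
      C_mul_mem_adjoin _ _, h0, by simp [h1]⟩, ?_⟩
    rw [DAut, DAut, h0, h1, hkey]
    rcases hp with hp | ⟨hp, hp'⟩
    · simp [Prod.Lex.toLex_lt_toLex, hp, hp.le]
    · simp [Prod.Lex.toLex_lt_toLex, hp, hp']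
end

section
/- Let Φ be an integral domain and z ∈ Φ. The Φ-algebra endomorphism σ of Φ[x₁,x₂] defined by σ(x₁) = x₁ + 2x₂w + zw² and σ(x₂) = x₂ + zw, where w = zx₁ − x₂², is an automorphism of Φ[x₁,x₂]. -/
open MvPolynomial

/-- `w = zx₁ − x₂²`. -/
noncomputable def nagataW {Φ : Type*} [CommRing Φ] (z : Φ) : MvPolynomial (Fin 2) Φ :=
  C z * X 0 - X 1 ^ 2

/-- The first component `x₁ + 2x₂w + zw²` of the Nagata endomorphism. -/
noncomputable def nagataF {Φ : Type*} [CommRing Φ] (z : Φ) : MvPolynomial (Fin 2) Φ :=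
  X 0 + 2 * X 1 * nagataW z + C z * nagataW z ^ 2

/-- The second component `x₂ + zw` of the Nagata endomorphism. -/
noncomputable def nagataG {Φ : Type*} [CommRing Φ] (z : Φ) : MvPolynomial (Fin 2) Φ :=
  X 1 + C z * nagataW z

/-- The Nagata endomorphism of `Φ[x₁,x₂]`: the `Φ`-algebra endomorphism with
`x₁ ↦ x₁ + 2x₂w + zw²` and `x₂ ↦ x₂ + zw`, where `w = zx₁ − x₂²`. -/
noncomputable def nagataEndo {Φ : Type*} [CommRing Φ] (z : Φ) :
    MvPolynomial (Fin 2) Φ →ₐ[Φ] MvPolynomial (Fin 2) Φ :=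
  aeval ![nagataF z, nagataG z]

/-- The `Φ`-algebra endomorphism `x₁ ↦ x₁ - 2x₂w + zw²`, `x₂ ↦ x₂ - zw`, the inverse of the
Nagata endomorphism. -/
noncomputable def nagataInv {Φ : Type*} [CommRing Φ] (z : Φ) :
    MvPolynomial (Fin 2) Φ →ₐ[Φ] MvPolynomial (Fin 2) Φ :=
  aeval ![X 0 - 2 * X 1 * nagataW z + C z * nagataW z ^ 2, X 1 - C z * nagataW z]

theorem nagataEndo_nagataW {Φ : Type*} [CommRing Φ] (z : Φ) :
    nagataEndo z (nagataW z) = nagataW z := by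
  simp only [nagataEndo, nagataW, nagataF, nagataG, map_sub, map_mul, map_pow, aeval_X, algHom_C,
    algebraMap_eq, Matrix.cons_val_zero, Matrix.cons_val_one]
  ring

theorem nagataInv_nagataW {Φ : Type*} [CommRing Φ] (z : Φ) :
    nagataInv z (nagataW z) = nagataW z := by
  simp only [nagataInv, nagataW, map_sub, map_mul, map_pow, aeval_X, algHom_C,
    algebraMap_eq, Matrix.cons_val_zero, Matrix.cons_val_one]
  ring

theorem nagataEndo_X_zero {Φ : Type*} [CommRing Φ] (z : Φ) :
    nagataEndo z (X 0) = nagataF z := by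
  simp [nagataEndo]

theorem nagataEndo_X_one {Φ : Type*} [CommRing Φ] (z : Φ) :
    nagataEndo z (X 1) = nagataG z := by
  simp [nagataEndo]

theorem nagataInv_X_zero {Φ : Type*} [CommRing Φ] (z : Φ) :
    nagataInv z (X 0) = X 0 - 2 * X 1 * nagataW z + C z * nagataW z ^ 2 := by
  simp [nagataInv]

theorem nagataInv_X_one {Φ : Type*} [CommRing Φ] (z : Φ) :
    nagataInv z (X 1) = X 1 - C z * nagataW z := by
  simp [nagataInv]

theorem nagataEndo_comp_nagataInv {Φ : Type*} [CommRing Φ] (z : Φ) :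
    (nagataEndo z).comp (nagataInv z) = AlgHom.id Φ _ := by
  refine algHom_ext fun i => ?_
  fin_cases i <;>
  · simp only [Fin.zero_eta, Fin.mk_one, AlgHom.comp_apply, AlgHom.id_apply, nagataInv_X_zero,
      nagataInv_X_one, map_add, map_sub, map_mul, map_pow, map_ofNat, algHom_C, algebraMap_eq,
      nagataEndo_nagataW, nagataEndo_X_zero, nagataEndo_X_one, nagataF, nagataG]
    ring

theorem nagataInv_comp_nagataEndo {Φ : Type*} [CommRing Φ] (z : Φ) :
    (nagataInv z).comp (nagataEndo z) = AlgHom.id Φ _ := by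
  refine algHom_ext fun i => ?_
  fin_cases i <;>
  · simp only [Fin.zero_eta, Fin.mk_one, AlgHom.comp_apply, AlgHom.id_apply, nagataEndo_X_zero,
      nagataEndo_X_one, nagataF, nagataG, map_add, map_mul, map_pow, map_ofNat, algHom_C,
      algebraMap_eq, nagataInv_nagataW, nagataInv_X_zero, nagataInv_X_one]
    ring

/-- Over an integral domain `Φ`, the Nagata endomorphism of `Φ[x₁,x₂]` given by
`σ(x₁) = x₁ + 2x₂w + zw²`, `σ(x₂) = x₂ + zw` with `w = zx₁ − x₂²` is an automorphism. -/
theorem nagata_is_automorphism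
    (Φ : Type*) [CommRing Φ] [IsDomain Φ] (z : Φ) :
    Function.Bijective (nagataEndo z) := by
  exact (AlgEquiv.ofAlgHom (nagataEndo z) (nagataInv z) (nagataEndo_comp_nagataInv z)
    (nagataInv_comp_nagataEndo z)).bijective
end

section
/- Let Φ be a Euclidean ring and z ∈ Φ a nonzero non-unit. The Nagata automorphism σ of Φ[x₁,x₂], defined by σ(x₁) = x₁ + 2x₂w + zw² and σ(x₂) = x₂ + zw with w = zx₁ − x₂², is wild, i.e., σ does not belong to the subgroup of Aut(Φ[x₁,x₂]) generated by elementary automorphisms. -/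
open MvPolynomial

/-- An automorphism of `Φ[x₁,x₂]` is elementary if it has the form
`(x₁ ↦ αx₁ + f(x₂), x₂ ↦ x₂)` or `(x₁ ↦ x₁, x₂ ↦ βx₂ + g(x₁))` with `α, β` units. -/
def IsElementary {Φ : Type*} [CommRing Φ] (σ : PolyAut Φ) : Prop :=
  (∃ (α : Φˣ) (f : MvPolynomial (Fin 2) Φ), f ∈ Algebra.adjoin Φ {(X 1 : MvPolynomial (Fin 2) Φ)} ∧
      σ (X 0) = C (α : Φ) * X 0 + f ∧ σ (X 1) = X 1) ∨
  (∃ (β : Φˣ) (g : MvPolynomial (Fin 2) Φ), g ∈ Algebra.adjoin Φ {(X 0 : MvPolynomial (Fin 2) Φ)} ∧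
      σ (X 0) = X 0 ∧ σ (X 1) = C (β : Φ) * X 1 + g)

/-- The subgroup of tame automorphisms of `Φ[x₁,x₂]`, generated by the elementary ones. -/
noncomputable def TameSubgroup (Φ : Type*) [CommRing Φ] : Subgroup (PolyAut Φ) :=
  Subgroup.closure {σ | IsElementary σ}

section ReducedPairs

open scoped Polynomial

variable {Φ : Type*} [CommRing Φ]

/-- The pair `q` is the image of the pair `p` under an invertible affine transformation
over `Φ`. -/
def AffineRel (p q : Φ[X][X] × Φ[X][X]) : Prop :=
  ∃ a b c d u v : Φ, IsUnit (a * d - b * c) ∧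
    q.1 = Polynomial.C (Polynomial.C a) * p.1 + Polynomial.C (Polynomial.C b) * p.2 +
      Polynomial.C (Polynomial.C u) ∧
    q.2 = Polynomial.C (Polynomial.C c) * p.1 + Polynomial.C (Polynomial.C d) * p.2 +
      Polynomial.C (Polynomial.C v)

/-- Pairs obtained from `(tX, X)` by an alternating word of affine transformations and
triangular transformations of degree at least two over `Φ`, such that every triangular
transformation is applied to a pair whose second component has maximal degree. -/
inductive ReducedPair : Φ[X][X] × Φ[X][X] → Prop
  | base : ReducedPair (Polynomial.C Polynomial.X * Polynomial.X, Polynomial.X)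
  | step (r q : Φ[X][X] × Φ[X][X]) (g : Φ[X]) : ReducedPair r → AffineRel r q →
      1 ≤ q.2.natDegree → q.1.natDegree ≤ q.2.natDegree → 2 ≤ g.natDegree →
      ReducedPair (q.1 + Polynomial.aeval q.2 g, q.2)

/-- Pairs which are affine images of reduced pairs. -/
def TamePair (p : Φ[X][X] × Φ[X][X]) : Prop :=
  ∃ r, ReducedPair r ∧ AffineRel r p

theorem AffineRel.refl (p : Φ[X][X] × Φ[X][X]) : AffineRel p p :=
  ⟨1, 0, 0, 1, 0, 0, by simp, by simp, by simp⟩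

theorem AffineRel.trans {p q r : Φ[X][X] × Φ[X][X]} (hpq : AffineRel p q)
    (hqr : AffineRel q r) : AffineRel p r := by
  obtain ⟨a, b, c, d, u, v, hu, h1, h2⟩ := hpq
  obtain ⟨a', b', c', d', u', v', hu', h1', h2'⟩ := hqr
  refine ⟨a' * a + b' * c, a' * b + b' * d, c' * a + d' * c, c' * b + d' * d,
    a' * u + b' * v + u', c' * u + d' * v + v', ?_, ?_, ?_⟩
  · convert hu'.mul hu using 1
    ring
  · rw [h1', h1, h2]
    simp only [map_add, map_mul]
    ring
  · rw [h2', h1, h2]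
    simp only [map_add, map_mul]
    ring

theorem TamePair.affine {p q : Φ[X][X] × Φ[X][X]} (hp : TamePair p) (h : AffineRel p q) :
    TamePair q :=
  let ⟨r, hr, hrp⟩ := hp
  ⟨r, hr, hrp.trans h⟩

theorem affineRel_triangular (p : Φ[X][X] × Φ[X][X]) {g : Φ[X]} (hg : g.natDegree ≤ 1) :
    AffineRel p (p.1 + Polynomial.aeval p.2 g, p.2) := by
  refine ⟨1, g.coeff 1, 0, 1, g.coeff 0, 0, by simp, ?_, by simp⟩
  conv_lhs => rw [Polynomial.eq_X_add_C_of_natDegree_le_one hg]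
  simp [Polynomial.algebraMap_apply, add_assoc]

theorem aeval_eq_comp_map (q : Φ[X][X]) (g : Φ[X]) :
    Polynomial.aeval q g = (g.map Polynomial.C).comp q := by
  rw [Polynomial.comp, Polynomial.eval₂_map, Polynomial.aeval_def]
  rfl

theorem TamePair.swap {p : Φ[X][X] × Φ[X][X]} (hp : TamePair p) : TamePair p.swap :=
  hp.affine ⟨0, 1, 1, 0, 0, 0, by simp, by simp, by simp⟩

theorem natDegree_CC_mul_le (a : Φ) (p : Φ[X][X]) :
    (Polynomial.C (Polynomial.C a) * p).natDegree ≤ p.natDegree :=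
  Polynomial.natDegree_C_mul_le _ _

theorem natDegree_affine_le (a b u : Φ) (p q : Φ[X][X]) (h : q.natDegree ≤ p.natDegree) :
    (Polynomial.C (Polynomial.C a) * p + Polynomial.C (Polynomial.C b) * q +
      Polynomial.C (Polynomial.C u)).natDegree ≤ p.natDegree := by
  rw [Polynomial.natDegree_add_C]
  exact Polynomial.natDegree_add_le_of_degree_le (natDegree_CC_mul_le a p)
    ((natDegree_CC_mul_le b q).trans h)

variable [IsDomain Φ]

theorem natDegree_aeval_eq_mul (q : Φ[X][X]) (g : Φ[X]) :
    (Polynomial.aeval q g).natDegree = g.natDegree * q.natDegree := by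
  rw [aeval_eq_comp_map, Polynomial.natDegree_comp,
    Polynomial.natDegree_map_eq_of_injective Polynomial.C_injective]

theorem leadingCoeff_aeval_eq (q : Φ[X][X]) (g : Φ[X]) (hq : q.natDegree ≠ 0) :
    (Polynomial.aeval q g).leadingCoeff =
      Polynomial.C g.leadingCoeff * q.leadingCoeff ^ g.natDegree := by
  rw [aeval_eq_comp_map, Polynomial.leadingCoeff_comp hq,
    Polynomial.leadingCoeff_map_of_injective Polynomial.C_injective,
    Polynomial.natDegree_map_eq_of_injective Polynomial.C_injective]

theorem natDegree_affine_eq {a : Φ} (ha : a ≠ 0) (b u : Φ) (p q : Φ[X][X])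
    (h : q.natDegree < p.natDegree) :
    (Polynomial.C (Polynomial.C a) * p + Polynomial.C (Polynomial.C b) * q +
      Polynomial.C (Polynomial.C u)).natDegree = p.natDegree := by
  have hp : (Polynomial.C (Polynomial.C a) * p).natDegree = p.natDegree :=
    Polynomial.natDegree_C_mul (by simpa using ha)
  rw [Polynomial.natDegree_add_C, Polynomial.natDegree_add_eq_left_of_natDegree_lt, hp]
  rw [hp]
  exact (natDegree_CC_mul_le b q).trans_lt h

theorem AffineRel.natDegree_le_of_base {p : Φ[X][X] × Φ[X][X]}
    (h : AffineRel (Polynomial.C Polynomial.X * Polynomial.X, Polynomial.X) p) :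
    p.1.natDegree ≤ 1 ∧ 1 ≤ p.2.natDegree := by
  obtain ⟨a, b, c, d, u, v, hu, h1, h2⟩ := h
  constructor
  · rw [h1]
    dsimp only
    compute_degree
  · apply Polynomial.le_natDegree_of_ne_zero
    intro h0
    have hcd : Polynomial.C c * Polynomial.X + Polynomial.C d = 0 := by
      simpa [h2, Polynomial.coeff_C, mul_assoc] using h0
    have hc : c = 0 := by simpa using congrArg (Polynomial.coeff · 1) hcd
    have hd : d = 0 := by simpa using congrArg (Polynomial.coeff · 0) hcd
    simp [hc, hd] at hu

theorem natDegree_lt_triangular {q : Φ[X][X] × Φ[X][X]} {g : Φ[X]}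
    (h1 : 1 ≤ q.2.natDegree) (hq : q.1.natDegree ≤ q.2.natDegree) (hg : 2 ≤ g.natDegree) :
    q.2.natDegree < (q.1 + Polynomial.aeval q.2 g).natDegree := by
  have hlt : q.2.natDegree < (Polynomial.aeval q.2 g).natDegree := by
    rw [natDegree_aeval_eq_mul]
    nlinarith
  rwa [Polynomial.natDegree_add_eq_right_of_natDegree_lt (hq.trans_lt hlt)]

/-- A tame pair with dominating first component is, up to a triangular affine
transformation, the result of a triangular transformation of a tame pair whose second
component has maximal degree. -/
theorem TamePair.exists_of_natDegree_lt {p : Φ[X][X] × Φ[X][X]} (hp : TamePair p)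
    (h : p.2.natDegree < p.1.natDegree) :
    ∃ (r q : Φ[X][X] × Φ[X][X]) (g : Φ[X]) (a b d u v : Φ), ReducedPair r ∧ AffineRel r q ∧
      1 ≤ q.2.natDegree ∧ q.1.natDegree ≤ q.2.natDegree ∧ IsUnit a ∧ IsUnit d ∧
      p.1 = Polynomial.C (Polynomial.C a) * (q.1 + Polynomial.aeval q.2 g) +
        Polynomial.C (Polynomial.C b) * q.2 + Polynomial.C (Polynomial.C u) ∧
      p.2 = Polynomial.C (Polynomial.C d) * q.2 + Polynomial.C (Polynomial.C v) := by
  obtain ⟨r, hr, hrp⟩ := hp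
  cases hr with
  | base =>
    obtain ⟨h1, h2⟩ := hrp.natDegree_le_of_base
    omega
  | step r q g hr hrq hq1 hq2 hg =>
    obtain ⟨a, b, c, d, u, v, hu, h1, h2⟩ := hrp
    have hlt := natDegree_lt_triangular hq1 hq2 hg
    have hc : c = 0 := by
      by_contra hc
      rw [h1, h2, natDegree_affine_eq hc _ _ _ _ hlt] at h
      exact absurd (natDegree_affine_le a b u _ _ hlt.le) (not_le.mpr h)
    subst hc
    rw [mul_zero, sub_zero, IsUnit.mul_iff] at hu
    exact ⟨r, q, g, a, b, d, u, v, hr, hrq, hq1, hq2, hu.1, hu.2, h1, by simpa using h2⟩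

theorem AffineRel.one_le_natDegree_snd {r q : Φ[X][X] × Φ[X][X]} (hr : ReducedPair r)
    (h : AffineRel r q) (hq : q.1.natDegree ≤ q.2.natDegree) : 1 ≤ q.2.natDegree := by
  cases hr with
  | base => exact h.natDegree_le_of_base.2
  | step r s g hr hrs hs1 hs2 hg =>
    obtain ⟨a, b, c, d, u, v, hu, h1, h2⟩ := h
    have hlt := natDegree_lt_triangular hs1 hs2 hg
    by_cases hc : c = 0
    · subst hc
      rw [mul_zero, sub_zero, IsUnit.mul_iff] at hu
      rw [h1, natDegree_affine_eq hu.1.ne_zero _ _ _ _ hlt] at hq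
      omega
    · rw [h2, natDegree_affine_eq hc _ _ _ _ hlt]
      omega

theorem TamePair.triangular {p : Φ[X][X] × Φ[X][X]} (hp : TamePair p) (g : Φ[X]) :
    TamePair (p.1 + Polynomial.aeval p.2 g, p.2) := by
  by_cases hg : g.natDegree ≤ 1
  · exact hp.affine (affineRel_triangular p hg)
  by_cases h : p.1.natDegree ≤ p.2.natDegree
  · obtain ⟨r, hr, hrp⟩ := hp
    exact ⟨_, .step r p g hr hrp (hrp.one_le_natDegree_snd hr h) h (by omega), .refl _⟩
  obtain ⟨r, q, k, a, b, d, u, v, hr, hrq, hq1, hq2, ha, hd, h1, h2⟩ :=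
    hp.exists_of_natDegree_lt (not_le.mp h)
  obtain ⟨a', ha'⟩ := ha.exists_right_inv
  let m : Φ[X] := k + Polynomial.C a' * (Polynomial.C b * Polynomial.X + Polynomial.C u +
    g.comp (Polynomial.C d * Polynomial.X + Polynomial.C v))
  have hm : TamePair (q.1 + Polynomial.aeval q.2 m, q.2) := by
    by_cases hmd : m.natDegree ≤ 1
    · exact ⟨r, hr, hrq.trans (affineRel_triangular q hmd)⟩
    · exact ⟨_, .step r q m hr hrq hq1 hq2 (by omega), .refl _⟩
  refine hm.affine ⟨a, 0, 0, d, 0, v, by simpa using ha.mul hd, ?_, by simpa using h2⟩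
  have haa : Polynomial.C (Polynomial.C a) * Polynomial.C (Polynomial.C a') =
      (1 : Φ[X][X]) := by
    rw [← map_mul, ← map_mul, ha', map_one, map_one]
  simp only [m, h1, h2, map_add, map_mul, Polynomial.aeval_C, Polynomial.aeval_X,
    Polynomial.aeval_comp, Polynomial.algebraMap_apply, Algebra.algebraMap_self,
    RingHom.id_apply, map_zero]
  linear_combination -(Polynomial.C (Polynomial.C b) * q.2 + Polynomial.C (Polynomial.C u) +
    Polynomial.aeval (Polynomial.C (Polynomial.C d) * q.2 + Polynomial.C (Polynomial.C v)) g) * haa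

theorem TamePair.elementary {p : Φ[X][X] × Φ[X][X]} (hp : TamePair p) (α : Φˣ) (g : Φ[X]) :
    TamePair (Polynomial.C (Polynomial.C (α : Φ)) * p.1 + Polynomial.aeval p.2 g, p.2) := by
  have h : TamePair (Polynomial.C (Polynomial.C (α : Φ)) * p.1, p.2) :=
    hp.affine ⟨α, 0, 0, 1, 0, 0, by simp, by simp, by simp⟩
  exact h.triangular g

end ReducedPairs

section TameSubgroup

variable {Φ : Type*} [CommRing Φ]

/-- The substitution `x₁ ↦ tX`, `x₂ ↦ X`, turning the total degree into the degree in `X`. -/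
noncomputable def homogenizeHom (Φ : Type*) [CommRing Φ] :
    MvPolynomial (Fin 2) Φ →ₐ[Φ] Polynomial (Polynomial Φ) :=
  aeval ![Polynomial.C Polynomial.X * Polynomial.X, Polynomial.X]

/-- The pair of components of an automorphism after the substitution `homogenizeHom`. -/
noncomputable def componentPair (φ : PolyAut Φ) :
    Polynomial (Polynomial Φ) × Polynomial (Polynomial Φ) :=
  (homogenizeHom Φ (φ (X 0)), homogenizeHom Φ (φ (X 1)))

theorem homogenizeHom_C (a : Φ) :
    homogenizeHom Φ (C a) = Polynomial.C (Polynomial.C a) := by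
  simp [homogenizeHom, Polynomial.algebraMap_apply]

theorem mem_adjoin_singleton_iff_exists_aeval {A : Type*} [CommRing A] [Algebra Φ A]
    {x y : A} : y ∈ Algebra.adjoin Φ {x} ↔ ∃ g : Polynomial Φ, Polynomial.aeval x g = y := by
  rw [Algebra.adjoin_singleton_eq_range_aeval]
  rfl

theorem AlgEquiv.apply_of_mem_adjoin_of_fixed {A : Type*} [CommRing A] [Algebra Φ A]
    (σ : A ≃ₐ[Φ] A) {x y : A} (hx : σ x = x) (hy : y ∈ Algebra.adjoin Φ {x}) : σ y = y := by
  obtain ⟨g, rfl⟩ := mem_adjoin_singleton_iff_exists_aeval.mp hy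
  rw [← Polynomial.aeval_algHom_apply, hx]

theorem IsElementary.inv {σ : PolyAut Φ} (h : IsElementary σ) : IsElementary σ⁻¹ := by
  have key : ∀ {i j : Fin 2} {α : Φˣ} {f : MvPolynomial (Fin 2) Φ},
      f ∈ Algebra.adjoin Φ {(X j : MvPolynomial (Fin 2) Φ)} →
      σ (X i) = C (α : Φ) * X i + f → σ (X j) = X j →
      -(C (↑α⁻¹ : Φ) * f) ∈ Algebra.adjoin Φ {(X j : MvPolynomial (Fin 2) Φ)} ∧
      σ⁻¹ (X i) = C (↑α⁻¹ : Φ) * X i + -(C (↑α⁻¹ : Φ) * f) ∧ σ⁻¹ (X j) = X j := by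
    intro i j α f hf hi hj
    refine ⟨neg_mem (mul_mem (Subalgebra.algebraMap_mem _ _) hf), ?_, ?_⟩
    · refine σ.symm_apply_eq.mpr ?_
      have hC : ∀ a : Φ, σ (C a) = C a := σ.commutes
      have hα : C (↑α⁻¹ : Φ) * C (α : Φ) = (1 : MvPolynomial (Fin 2) Φ) := by
        rw [← map_mul, Units.inv_mul, map_one]
      rw [map_add, map_neg, map_mul, map_mul, hC, hi, σ.apply_of_mem_adjoin_of_fixed hj hf]
      linear_combination -X i * hα
    · exact σ.symm_apply_eq.mpr hj.symm
  rcases h with ⟨α, f, hf, h0, h1⟩ | ⟨β, g, hg, h0, h1⟩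
  · exact Or.inl ⟨α⁻¹, _, key hf h0 h1⟩
  · obtain ⟨h2, h3, h4⟩ := key hg h1 h0
    exact Or.inr ⟨β⁻¹, _, h2, h4, h3⟩

variable [IsDomain Φ]

theorem TamePair.mul_elementary {σ τ : PolyAut Φ} (hσ : TamePair (componentPair σ))
    (hτ : IsElementary τ) : TamePair (componentPair (σ * τ)) := by
  have hC : ∀ a : Φ, σ (C a) = C a := σ.commutes
  rcases hτ with ⟨α, f, hf, h0, h1⟩ | ⟨α, f, hf, h0, h1⟩
  all_goals obtain ⟨g, rfl⟩ := mem_adjoin_singleton_iff_exists_aeval.mp hf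
  · convert hσ.elementary α g using 1
    simp only [componentPair, AlgEquiv.mul_apply, h0, h1, map_add, map_mul, hC,
      homogenizeHom_C, ← Polynomial.aeval_algHom_apply]
  · convert (hσ.swap.elementary α g).swap using 1
    simp only [componentPair, AlgEquiv.mul_apply, h0, h1, map_add, map_mul, hC,
      homogenizeHom_C, ← Polynomial.aeval_algHom_apply, Prod.swap]

theorem tamePair_componentPair {σ : PolyAut Φ} (hσ : σ ∈ TameSubgroup Φ) :
    TamePair (componentPair σ) := by
  induction hσ using Subgroup.closure_induction_right with
  | one =>
    refine ⟨_, .base, ?_⟩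
    convert AffineRel.refl _ using 1
    simp [componentPair, homogenizeHom]
  | mul_right σ _ τ hτ ih => exact ih.mul_elementary hτ
  | mul_inv_cancel σ _ τ hτ ih => exact ih.mul_elementary (IsElementary.inv hτ)

/-- If the first component of a tame pair has larger degree than the second one, then its
leading term is a multiple over `Φ` of a power of the leading term of the second one. -/
theorem TamePair.exists_leadingCoeff_eq
    {p : Polynomial (Polynomial Φ) × Polynomial (Polynomial Φ)}
    (hp : TamePair p) (h : p.2.natDegree < p.1.natDegree) :
    ∃ (c : Φ) (k : ℕ), p.1.natDegree = k * p.2.natDegree ∧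
      p.1.leadingCoeff = Polynomial.C c * p.2.leadingCoeff ^ k := by
  obtain ⟨r, q, k, a, b, d, u, v, hr, hrq, hq1, hq2, ha, hd, h1, h2⟩ :=
    hp.exists_of_natDegree_lt h
  obtain ⟨d', hd'⟩ := hd.exists_right_inv
  have hdd : Polynomial.C (Polynomial.C d) * Polynomial.C (Polynomial.C d') =
      (1 : Polynomial (Polynomial Φ)) := by
    rw [← map_mul, ← map_mul, hd', map_one, map_one]
  have hdeg : p.2.natDegree = q.2.natDegree := by
    rw [h2, Polynomial.natDegree_add_C, Polynomial.natDegree_C_mul]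
    simpa using hd.ne_zero
  let m : Polynomial Φ := (Polynomial.C a * k + Polynomial.C b * Polynomial.X +
    Polynomial.C u).comp (Polynomial.C d' * (Polynomial.X - Polynomial.C v))
  have hq : Polynomial.C (Polynomial.C d') * (p.2 - Polynomial.C (Polynomial.C v)) = q.2 := by
    rw [h2]
    linear_combination q.2 * hdd
  have hm : p.1 = Polynomial.C (Polynomial.C a) * q.1 + Polynomial.aeval p.2 m := by
    simp only [m, map_add, map_mul, map_sub, Polynomial.aeval_C, Polynomial.aeval_X,
      Polynomial.aeval_comp, Polynomial.algebraMap_apply, Algebra.algebraMap_self,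
      RingHom.id_apply, hq, h1]
    ring
  have hlow : (Polynomial.C (Polynomial.C a) * q.1).natDegree ≤ p.2.natDegree :=
    (natDegree_CC_mul_le a q.1).trans (hq2.trans hdeg.ge)
  have hlt : (Polynomial.C (Polynomial.C a) * q.1).natDegree <
      (Polynomial.aeval p.2 m).natDegree := by
    by_contra hcon
    have := Polynomial.natDegree_add_le_of_degree_le hlow ((not_lt.mp hcon).trans hlow)
    rw [← hm] at this
    omega
  refine ⟨m.leadingCoeff, m.natDegree, ?_, ?_⟩
  · rw [← natDegree_aeval_eq_mul, hm, Polynomial.natDegree_add_eq_right_of_natDegree_lt hlt]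
  · rw [← leadingCoeff_aeval_eq _ _ (by omega), hm,
      Polynomial.leadingCoeff_add_of_degree_lt (Polynomial.degree_lt_degree hlt)]

end TameSubgroup

/-- Over a Euclidean ring `Φ` and a nonzero non-unit `z ∈ Φ`, the Nagata automorphism
`σ = (x₁ + 2x₂w + zw², x₂ + zw)`, `w = zx₁ − x₂²`, of `Φ[x₁,x₂]` is wild: it does not lie
in the subgroup of `Aut(Φ[x₁,x₂])` generated by the elementary automorphisms. -/
theorem nagata_automorphism_is_wild
    (Φ : Type*) [CommRing Φ] [IsDomain Φ] (ν : Φ → ℕ) (hν : IsEuclideanNorm Φ ν)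
    (z : Φ) (hz0 : z ≠ 0) (hz : ¬ IsUnit z)
    (σ : PolyAut Φ)
    (hσ1 : σ (X 0) = X 0 + 2 * X 1 * nagataW z + C z * nagataW z ^ 2)
    (hσ2 : σ (X 1) = X 1 + C z * nagataW z) :
    σ ∉ TameSubgroup Φ := by
  intro hmem
  have hp := tamePair_componentPair hmem
  have h1 : (componentPair σ).1 =
      Polynomial.C Polynomial.X * Polynomial.X + 2 * Polynomial.X *
        (Polynomial.C (Polynomial.C z) * (Polynomial.C Polynomial.X * Polynomial.X) -
          Polynomial.X ^ 2) +
      Polynomial.C (Polynomial.C z) *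
        (Polynomial.C (Polynomial.C z) * (Polynomial.C Polynomial.X * Polynomial.X) -
          Polynomial.X ^ 2) ^ 2 := by
    simp only [componentPair, hσ1, nagataW, map_add, map_mul, map_sub, map_pow,
      homogenizeHom_C, map_ofNat]
    simp [homogenizeHom]
  have h2 : (componentPair σ).2 = Polynomial.X + Polynomial.C (Polynomial.C z) *
        (Polynomial.C (Polynomial.C z) * (Polynomial.C Polynomial.X * Polynomial.X) -
          Polynomial.X ^ 2) := by
    simp only [componentPair, hσ2, nagataW, map_add, map_mul, map_sub, map_pow,
      homogenizeHom_C]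
    simp [homogenizeHom]
  have hzC : (Polynomial.C z : Polynomial Φ) ≠ 0 := by simpa using hz0
  have h1' : (componentPair σ).1 = Polynomial.C (Polynomial.C z) * Polynomial.X ^ 4 +
      Polynomial.C (-2 - 2 * Polynomial.C z ^ 2 * Polynomial.X) * Polynomial.X ^ 3 +
      Polynomial.C (2 * Polynomial.C z * Polynomial.X +
        Polynomial.C z ^ 3 * Polynomial.X ^ 2) * Polynomial.X ^ 2 +
      Polynomial.C Polynomial.X * Polynomial.X := by
    rw [h1]
    simp only [map_add, map_sub, map_mul, map_pow, map_neg, map_ofNat]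
    ring
  have h2' : (componentPair σ).2 = Polynomial.C (-Polynomial.C z) * Polynomial.X ^ 2 +
      Polynomial.C (1 + Polynomial.C z ^ 2 * Polynomial.X) * Polynomial.X +
      Polynomial.C 0 := by
    rw [h2]
    simp only [map_add, map_mul, map_pow, map_neg, map_one, map_zero]
    ring
  have hd1 : (componentPair σ).1.natDegree = 4 := by
    rw [h1']
    compute_degree!
  have hd2 : (componentPair σ).2.natDegree = 2 := by
    rw [h2', Polynomial.natDegree_quadratic (neg_ne_zero.mpr hzC)]
  obtain ⟨c, k, hk, hc⟩ := hp.exists_leadingCoeff_eq (by omega)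
  rw [hd1, hd2] at hk
  obtain rfl : k = 2 := by omega
  have hl1 : (componentPair σ).1.leadingCoeff = Polynomial.C z := by
    rw [Polynomial.leadingCoeff, hd1, h1']
    simp [Polynomial.coeff_X_pow, -map_add, -map_sub, -map_mul]
  have hl2 : (componentPair σ).2.leadingCoeff = -Polynomial.C z := by
    rw [h2', Polynomial.leadingCoeff_quadratic (neg_ne_zero.mpr hzC)]
  rw [hl1, hl2, neg_sq, ← map_pow, ← map_mul] at hc
  have hcz := Polynomial.C_injective hc
  refine hz (IsUnit.of_mul_eq_one c (mul_left_cancel₀ hz0 ?_))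
  linear_combination -hcz
end

section
/- Let Φ be an integral domain, z ∈ Φ, and A = Φ⟨x₁,x₂⟩ the free nonassociative algebra on generators x₁, x₂ over Φ. The Φ-algebra endomorphism η of A defined by η(x₁) = x₁ + x₂(zx₁ − x₂²) + (zx₁ − x₂²)x₂ + z(zx₁ − x₂²)² and η(x₂) = x₂ + z(zx₁ − x₂²) is an automorphism of A. -/
open MvPolynomial

/-- The free nonassociative (non-unital, non-associative) algebra `Φ⟨x₁,x₂⟩` on two free
generators over `Φ`, i.e. the magma algebra of the free magma on two generators. -/
abbrev FNA (Φ : Type*) [CommRing Φ] := FreeNonUnitalNonAssocAlgebra Φ (Fin 2)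

/-- The free generators `x₁, x₂` of `Φ⟨x₁,x₂⟩`. -/
noncomputable def fnaX (Φ : Type*) [CommRing Φ] (i : Fin 2) : FNA Φ :=
  FreeNonUnitalNonAssocAlgebra.of Φ i

/-- A `Φ`-algebra automorphism of `A = Φ⟨x₁,x₂⟩`: an additive and multiplicative
equivalence of `A` which is moreover `Φ`-linear. -/
def IsAlgAut {Φ : Type*} [CommRing Φ] (e : FNA Φ ≃+* FNA Φ) : Prop :=
  ∀ (c : Φ) (x : FNA Φ), e (c • x) = c • e x

/-- An automorphism of `A = Φ⟨x₁,x₂⟩` is elementary if it is `Φ`-linear and has the form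
`(x₁ ↦ αx₁ + g, x₂ ↦ x₂)` with `α` a unit and `g` in the subalgebra generated by `x₂`, or
`(x₁ ↦ x₁, x₂ ↦ βx₂ + h)` with `β` a unit and `h` in the subalgebra generated by `x₁`. -/
def IsElementaryFNA {Φ : Type*} [CommRing Φ] (e : FNA Φ ≃+* FNA Φ) : Prop :=
  IsAlgAut e ∧
  ((∃ (α : Φˣ) (g : FNA Φ), g ∈ NonUnitalAlgebra.adjoin Φ {fnaX Φ 1} ∧
      e (fnaX Φ 0) = (α : Φ) • fnaX Φ 0 + g ∧ e (fnaX Φ 1) = fnaX Φ 1) ∨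
   (∃ (β : Φˣ) (h : FNA Φ), h ∈ NonUnitalAlgebra.adjoin Φ {fnaX Φ 0} ∧
      e (fnaX Φ 0) = fnaX Φ 0 ∧ e (fnaX Φ 1) = (β : Φ) • fnaX Φ 1 + h))

/-- The subgroup of tame automorphisms of `Φ⟨x₁,x₂⟩`, generated by the elementary ones. -/
noncomputable def TameFNA (Φ : Type*) [CommRing Φ] : Subgroup (RingAut (FNA Φ)) :=
  Subgroup.closure {e | IsElementaryFNA e}

/-- `w = zx₁ − x₂²` in `Φ⟨x₁,x₂⟩`. -/
noncomputable def fnaW {Φ : Type*} [CommRing Φ] (z : Φ) : FNA Φ :=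
  z • fnaX Φ 0 - fnaX Φ 1 * fnaX Φ 1

/-- `b₁ = x₁ + x₂(zx₁ − x₂²) + (zx₁ − x₂²)x₂ + z(zx₁ − x₂²)²`. -/
noncomputable def etaB₁ {Φ : Type*} [CommRing Φ] (z : Φ) : FNA Φ :=
  fnaX Φ 0 + fnaX Φ 1 * fnaW z + fnaW z * fnaX Φ 1 + z • (fnaW z * fnaW z)

/-- `b₂ = x₂ + z(zx₁ − x₂²)`. -/
noncomputable def etaB₂ {Φ : Type*} [CommRing Φ] (z : Φ) : FNA Φ :=
  fnaX Φ 1 + z • fnaW z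

/-- The endomorphism `x₁ ↦ x₁ + t(x₂w + wx₂) + t²zw²`, `x₂ ↦ x₂ + tzw` of `Φ⟨x₁,x₂⟩`, where
`w = zx₁ − x₂²`. -/
noncomputable def fnaFlow {Φ : Type*} [CommRing Φ] (z t : Φ) : FNA Φ →ₙₐ[Φ] FNA Φ :=
  FreeNonUnitalNonAssocAlgebra.lift Φ
    ![fnaX Φ 0 + t • (fnaX Φ 1 * fnaW z + fnaW z * fnaX Φ 1) + (t ^ 2 * z) • (fnaW z * fnaW z),
      fnaX Φ 1 + (t * z) • fnaW z]

section fnaFlow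

variable {Φ : Type*} [CommRing Φ] (z s t : Φ)

theorem fnaFlow_X_zero :
    fnaFlow z t (fnaX Φ 0) = fnaX Φ 0 + t • (fnaX Φ 1 * fnaW z + fnaW z * fnaX Φ 1) +
      (t ^ 2 * z) • (fnaW z * fnaW z) := by
  simp [fnaFlow, fnaX]

theorem fnaFlow_X_one : fnaFlow z t (fnaX Φ 1) = fnaX Φ 1 + (t * z) • fnaW z := by
  simp [fnaFlow, fnaX]

theorem fnaFlow_fnaW : fnaFlow z t (fnaW z) = fnaW z := by
  have h : fnaFlow z t (fnaW z) =
      z • fnaFlow z t (fnaX Φ 0) - fnaFlow z t (fnaX Φ 1) * fnaFlow z t (fnaX Φ 1) := by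
    conv_lhs => rw [fnaW, map_sub, map_smul, map_mul]
  rw [h, fnaFlow_X_zero, fnaFlow_X_one]
  simp only [mul_add, add_mul, smul_mul_assoc, mul_smul_comm]
  conv_rhs => rw [fnaW]
  module

theorem fnaFlow_comp : (fnaFlow z s).comp (fnaFlow z t) = fnaFlow z (s + t) := by
  refine FreeNonUnitalNonAssocAlgebra.hom_ext Φ (Fin.forall_fin_two.2 ⟨?_, ?_⟩)
  · change fnaFlow z s (fnaFlow z t (fnaX Φ 0)) = fnaFlow z (s + t) (fnaX Φ 0)
    simp only [fnaFlow_X_zero, fnaFlow_X_one, fnaFlow_fnaW, map_add, map_smul, map_mul,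
      mul_add, add_mul, smul_mul_assoc, mul_smul_comm]
    module
  · change fnaFlow z s (fnaFlow z t (fnaX Φ 1)) = fnaFlow z (s + t) (fnaX Φ 1)
    simp only [fnaFlow_X_one, fnaFlow_fnaW, map_add, map_smul]
    module

theorem fnaFlow_zero : fnaFlow z 0 = NonUnitalAlgHom.id Φ (FNA Φ) := by
  refine FreeNonUnitalNonAssocAlgebra.hom_ext Φ (Fin.forall_fin_two.2 ⟨?_, ?_⟩)
  · change fnaFlow z 0 (fnaX Φ 0) = fnaX Φ 0
    simp [fnaFlow_X_zero]
  · change fnaFlow z 0 (fnaX Φ 1) = fnaX Φ 1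
    simp [fnaFlow_X_one]

theorem fnaFlow_leftInverse : Function.LeftInverse (fnaFlow z (-t)) (fnaFlow z t) := fun x => by
  simpa [fnaFlow_zero] using DFunLike.congr_fun (fnaFlow_comp z (-t) t) x

theorem fnaFlow_bijective : Function.Bijective (fnaFlow z t) :=
  ⟨(fnaFlow_leftInverse z t).injective,
    Function.RightInverse.surjective (g := fnaFlow z (-t)) fun x => by
      simpa using fnaFlow_leftInverse z (-t) x⟩

theorem fnaFlow_one :
    fnaFlow z 1 = FreeNonUnitalNonAssocAlgebra.lift Φ ![etaB₁ z, etaB₂ z] := by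
  simp [fnaFlow, etaB₁, etaB₂, add_assoc]

end fnaFlow

/-- Over an integral domain `Φ`, the endomorphism `η` of the free nonassociative algebra
`A = Φ⟨x₁,x₂⟩` with `η(x₁) = x₁ + x₂(zx₁ − x₂²) + (zx₁ − x₂²)x₂ + z(zx₁ − x₂²)²` and
`η(x₂) = x₂ + z(zx₁ − x₂²)` is an automorphism of `A`. -/
theorem eta_is_automorphism
    (Φ : Type*) [CommRing Φ] [IsDomain Φ] (z : Φ) :
    Function.Bijective
      (FreeNonUnitalNonAssocAlgebra.lift Φ ![etaB₁ z, etaB₂ z] : FNA Φ →ₙₐ[Φ] FNA Φ) := by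
  exact fnaFlow_one z ▸ fnaFlow_bijective z 1
end

section
/- Let Φ be an integral domain, A = Φ⟨x₁,x₂⟩ the free nonassociative algebra on x₁, x₂ over Φ, and τ : A → Φ[x,y] the Φ-algebra homomorphism determined by τ(x₁) = x and τ(x₂) = y. If ψ is an automorphism of A with ψ(x₁) = b₁ and ψ(x₂) = b₂, then the Φ-algebra endomorphism τ*(ψ) of Φ[x,y] determined by x ↦ τ(b₁), y ↦ τ(b₂) is an automorphism of Φ[x,y]; moreover, if ψ is a tame automorphism of A, then τ*(ψ) is a tame automorphism of Φ[x,y]. -/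
open MvPolynomial

/-- `τ : A → Φ[x,y]`, the non-unital `Φ`-algebra homomorphism with `τ(x₁) = x`,
`τ(x₂) = y`. -/
noncomputable def tauHom (Φ : Type*) [CommRing Φ] :
    FNA Φ →ₙₐ[Φ] MvPolynomial (Fin 2) Φ :=
  FreeNonUnitalNonAssocAlgebra.lift Φ ![(X 0 : MvPolynomial (Fin 2) Φ), X 1]

theorem tauHom_fnaX {Φ : Type*} [CommRing Φ] (i : Fin 2) : tauHom Φ (fnaX Φ i) = X i := by
  fin_cases i <;> simp [tauHom, fnaX]

/-- An endomorphism of `Φ[x,y]` that agrees with `τ ∘ ψ` on the generators satisfies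
`σ ∘ τ = τ ∘ ψ`. -/
theorem apply_tauHom_of_apply_X {Φ : Type*} [CommRing Φ] {ψ : FNA Φ ≃+* FNA Φ}
    (hψ : IsAlgAut ψ) (σ : MvPolynomial (Fin 2) Φ →ₐ[Φ] MvPolynomial (Fin 2) Φ)
    (hσ : ∀ i, σ (X i) = tauHom Φ (ψ (fnaX Φ i))) (a : FNA Φ) :
    σ (tauHom Φ a) = tauHom Φ (ψ a) := by
  let ψ' : FNA Φ →ₙₐ[Φ] FNA Φ :=
    { toFun := ψ
      map_smul' := hψ
      map_zero' := map_zero ψ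
      map_add' := map_add ψ
      map_mul' := map_mul ψ }
  have h : (σ : MvPolynomial (Fin 2) Φ →ₙₐ[Φ] MvPolynomial (Fin 2) Φ).comp (tauHom Φ) =
      (tauHom Φ).comp ψ' := by
    refine FreeNonUnitalNonAssocAlgebra.hom_ext Φ fun i => ?_
    change σ (tauHom Φ (fnaX Φ i)) = tauHom Φ (ψ (fnaX Φ i))
    rw [tauHom_fnaX, hσ]
  exact DFunLike.congr_fun h a

theorem IsAlgAut.symm {Φ : Type*} [CommRing Φ] {ψ : FNA Φ ≃+* FNA Φ} (hψ : IsAlgAut ψ) :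
    IsAlgAut ψ.symm := fun c x => by
  rw [RingEquiv.symm_apply_eq, hψ, RingEquiv.apply_symm_apply]

/-- The endomorphism `τ*(ψ)` of `Φ[x,y]`. -/
noncomputable def tauStar {Φ : Type*} [CommRing Φ] (ψ : FNA Φ ≃+* FNA Φ) :
    MvPolynomial (Fin 2) Φ →ₐ[Φ] MvPolynomial (Fin 2) Φ :=
  aeval fun i => tauHom Φ (ψ (fnaX Φ i))

theorem tauStar_X {Φ : Type*} [CommRing Φ] (ψ : FNA Φ ≃+* FNA Φ) (i : Fin 2) :
    tauStar ψ (X i) = tauHom Φ (ψ (fnaX Φ i)) := by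
  simp [tauStar]

theorem tauStar_tauHom {Φ : Type*} [CommRing Φ] {ψ : FNA Φ ≃+* FNA Φ} (hψ : IsAlgAut ψ)
    (a : FNA Φ) : tauStar ψ (tauHom Φ a) = tauHom Φ (ψ a) :=
  apply_tauHom_of_apply_X hψ _ (tauStar_X ψ) a

theorem tauStar_comp_tauStar_symm {Φ : Type*} [CommRing Φ] {ψ : FNA Φ ≃+* FNA Φ}
    (hψ : IsAlgAut ψ) : (tauStar ψ).comp (tauStar ψ.symm) = AlgHom.id Φ _ := by
  refine MvPolynomial.algHom_ext fun i => ?_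
  rw [AlgHom.comp_apply, tauStar_X, tauStar_tauHom hψ, RingEquiv.apply_symm_apply, tauHom_fnaX,
    AlgHom.id_apply]

/-- The automorphism `τ*(ψ)` of `Φ[x,y]`. -/
noncomputable def tauStarEquiv {Φ : Type*} [CommRing Φ] {ψ : FNA Φ ≃+* FNA Φ}
    (hψ : IsAlgAut ψ) : PolyAut Φ :=
  AlgEquiv.ofAlgHom (tauStar ψ) (tauStar ψ.symm) (tauStar_comp_tauStar_symm hψ)
    (tauStar_comp_tauStar_symm hψ.symm)

theorem tauHom_mem_adjoin {Φ : Type*} [CommRing Φ] {i : Fin 2} {g : FNA Φ}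
    (hg : g ∈ NonUnitalAlgebra.adjoin Φ {fnaX Φ i}) :
    tauHom Φ g ∈ Algebra.adjoin Φ {(X i : MvPolynomial (Fin 2) Φ)} := by
  induction hg using NonUnitalAlgebra.adjoin_induction with
  | mem x hx =>
    rw [Set.mem_singleton_iff.mp hx, tauHom_fnaX]
    exact Algebra.subset_adjoin rfl
  | add x y _ _ hx hy => simpa using add_mem hx hy
  | zero => simp
  | mul x y _ _ hx hy => simpa using mul_mem hx hy
  | smul r x _ hx => simpa using Subalgebra.smul_mem _ hx r

theorem IsElementaryFNA.isElementary_tauStarEquiv {Φ : Type*} [CommRing Φ]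
    {ψ : FNA Φ ≃+* FNA Φ} (hψ : IsElementaryFNA ψ) : IsElementary (tauStarEquiv hψ.1) := by
  have hX (i : Fin 2) : tauStarEquiv hψ.1 (X i) = tauHom Φ (ψ (fnaX Φ i)) := tauStar_X ψ i
  rcases hψ.2 with ⟨α, g, hg, h0, h1⟩ | ⟨α, g, hg, h0, h1⟩
  · refine Or.inl ⟨α, tauHom Φ g, tauHom_mem_adjoin hg, ?_, ?_⟩
    · rw [hX, h0, map_add, map_smul, tauHom_fnaX, smul_eq_C_mul]
    · rw [hX, h1, tauHom_fnaX]
  · refine Or.inr ⟨α, tauHom Φ g, tauHom_mem_adjoin hg, ?_, ?_⟩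
    · rw [hX, h0, tauHom_fnaX]
    · rw [hX, h1, map_add, map_smul, tauHom_fnaX, smul_eq_C_mul]

/-- Every tame automorphism of `Φ⟨x₁,x₂⟩` descends along `τ` to a tame automorphism of
`Φ[x,y]`. -/
theorem exists_mem_tameSubgroup_of_mem_tameFNA {Φ : Type*} [CommRing Φ]
    {ψ : RingAut (FNA Φ)} (hψ : ψ ∈ TameFNA Φ) :
    ∃ σ ∈ TameSubgroup Φ, ∀ a, σ (tauHom Φ a) = tauHom Φ (ψ a) := by
  induction hψ using Subgroup.closure_induction with
  | mem e he =>
    exact ⟨tauStarEquiv he.1, Subgroup.subset_closure he.isElementary_tauStarEquiv,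
      tauStar_tauHom he.1⟩
  | one => exact ⟨1, one_mem _, fun _ => rfl⟩
  | mul e₁ e₂ _ _ h₁ h₂ =>
    obtain ⟨σ₁, hσ₁, h₁⟩ := h₁
    obtain ⟨σ₂, hσ₂, h₂⟩ := h₂
    refine ⟨σ₁ * σ₂, mul_mem hσ₁ hσ₂, fun a => ?_⟩
    rw [AlgEquiv.mul_apply, h₂, h₁, RingAut.mul_apply]
  | inv e _ h =>
    obtain ⟨σ, hσ, h⟩ := h
    refine ⟨σ⁻¹, inv_mem hσ, fun a => ?_⟩
    refine σ.injective ?_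
    rw [h]
    exact (σ.apply_symm_apply _).trans (congrArg _ (e.apply_symm_apply a).symm)

/-- If `ψ` is a (`Φ`-linear) automorphism of `A = Φ⟨x₁,x₂⟩` with `ψ(x₁) = b₁`,
`ψ(x₂) = b₂`, then the `Φ`-algebra endomorphism `τ*(ψ)` of `Φ[x,y]` determined by
`x ↦ τ(b₁)`, `y ↦ τ(b₂)` is an automorphism of `Φ[x,y]`; moreover, if `ψ` is tame,
then `τ*(ψ)` is a tame automorphism of `Φ[x,y]`. -/
theorem tau_star_of_automorphism
    (Φ : Type*) [CommRing Φ] [IsDomain Φ]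
    (ψ : FNA Φ ≃+* FNA Φ) (hψ : IsAlgAut ψ)
    (b₁ b₂ : FNA Φ) (hb₁ : ψ (fnaX Φ 0) = b₁) (hb₂ : ψ (fnaX Φ 1) = b₂) :
    Function.Bijective
      (aeval ![tauHom Φ b₁, tauHom Φ b₂] :
        MvPolynomial (Fin 2) Φ →ₐ[Φ] MvPolynomial (Fin 2) Φ) ∧
    (ψ ∈ TameFNA Φ →
      ∃ σ : PolyAut Φ, σ ∈ TameSubgroup Φ ∧
        σ (X 0) = tauHom Φ b₁ ∧ σ (X 1) = tauHom Φ b₂) := by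
  subst hb₁ hb₂
  refine ⟨?_, fun h => ?_⟩
  · have he : (aeval ![tauHom Φ (ψ (fnaX Φ 0)), tauHom Φ (ψ (fnaX Φ 1))] :
        MvPolynomial (Fin 2) Φ →ₐ[Φ] MvPolynomial (Fin 2) Φ) = tauStar ψ := by
      refine MvPolynomial.algHom_ext fun i => ?_
      rw [tauStar_X]
      fin_cases i <;> simp
    rw [he]
    exact (tauStarEquiv hψ).bijective
  · obtain ⟨σ, hσ, h⟩ := exists_mem_tameSubgroup_of_mem_tameFNA h
    exact ⟨σ, hσ, by rw [← h, tauHom_fnaX], by rw [← h, tauHom_fnaX]⟩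
end
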